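/- Let d ≥ 1 and let X be a d²×d² complex matrix, indexed by pairs ((i,j),(k,l)) with i,j,k,l ∈ Fin d. Then X commutes with O ⊗ O for every real orthogonal d×d matrix O (viewed as a complex matrix via the canonical embedding, with ⊗ the Kronecker product) if and only if X is a complex linear combination of the identity matrix, the swap matrix S (with entries S((i,j),(k,l)) = 1 if i = l and j = k, and 0 otherwise), and the matrix E (with entries E((i,j),(k,l)) = 1 if i = j and k = l, and 0 otherwise, i.e. E = d·|Φ⟩⟨Φ| for the maximally entangled unit vector |Φ⟩ = d^{-1/2} ∑_i e_i ⊗ e_i). -/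

import Mathlib

open Matrix Kronecker

/-- The swap matrix `S((i,j),(k,l)) = 1` iff `i = l ∧ j = k`. -/
def swapMat (d : ℕ) : Matrix (Fin d × Fin d) (Fin d × Fin d) ℂ :=
  Matrix.of fun p q => if p.1 = q.2 ∧ p.2 = q.1 then 1 else 0

/-- The matrix `E((i,j),(k,l)) = 1` iff `i = j ∧ k = l`, i.e. `E = d·|Φ⟩⟨Φ|` for the
maximally entangled unit vector `|Φ⟩`. -/
def eMat (d : ℕ) : Matrix (Fin d × Fin d) (Fin d × Fin d) ℂ :=
  Matrix.of fun p q => if p.1 = p.2 ∧ q.1 = q.2 then 1 else 0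

/-- `X` commutes with the two-fold diagonal action of the orthogonal matrix group. -/
def CommutesDiagonalOrthogonal {d : ℕ} (X : Matrix (Fin d × Fin d) (Fin d × Fin d) ℂ) : Prop :=
  ∀ O : Matrix (Fin d) (Fin d) ℝ, O * Oᵀ = 1 →
    X * ((O.map (Complex.ofReal)) ⊗ₖ (O.map (Complex.ofReal)))
      = ((O.map (Complex.ofReal)) ⊗ₖ (O.map (Complex.ofReal))) * X

namespace CommutesDiagonalOrthogonal

variable {d : ℕ} {X : Matrix (Fin d × Fin d) (Fin d × Fin d) ℂ}

lemma sum_eq (h : CommutesDiagonalOrthogonal X) {O : Matrix (Fin d) (Fin d) ℝ}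
    (hO : O * Oᵀ = 1) (p q : Fin d × Fin d) :
    ∑ r : Fin d × Fin d, X p r * ((O r.1 q.1 : ℂ) * (O r.2 q.2 : ℂ))
      = ∑ r : Fin d × Fin d, ((O p.1 r.1 : ℂ) * (O p.2 r.2 : ℂ)) * X r q := by
  simpa [Matrix.mul_apply, kroneckerMap_apply] using congrFun (congrFun (h O hO) p) q

lemma apply_perm (h : CommutesDiagonalOrthogonal X) (σ : Equiv.Perm (Fin d)) (i j k l : Fin d) :
    X (σ i, σ j) (σ k, σ l) = X (i, j) (k, l) := by
  have hO : ((1 : Matrix (Fin d) (Fin d) ℝ).submatrix id σ)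
      * ((1 : Matrix (Fin d) (Fin d) ℝ).submatrix id σ)ᵀ = 1 := by
    rw [transpose_submatrix, submatrix_mul_equiv]
    simp
  have hσ (a : Fin d) : (1 : Matrix (Fin d) (Fin d) ℝ).submatrix id σ (σ a) a = 1 :=
    one_apply_eq _
  have := h.sum_eq hO (σ i, σ j) (k, l)
  rw [Fintype.sum_eq_single (σ k, σ l), Fintype.sum_eq_single (i, j)] at this
  · simpa only [hσ, Complex.ofReal_one, mul_one, one_mul] using this
  · rintro ⟨a, b⟩ hab
    by_cases h1 : i = a <;> by_cases h2 : j = b <;> simp_all [one_apply]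
  · rintro ⟨a, b⟩ hab
    by_cases h1 : a = σ k <;> by_cases h2 : b = σ l <;> simp_all [one_apply]

lemma sign_mul (h : CommutesDiagonalOrthogonal X) (a i j k l : Fin d) :
    X (i, j) (k, l) * ((if k = a then -1 else 1) * (if l = a then -1 else 1))
      = (if i = a then -1 else 1) * (if j = a then -1 else 1) * X (i, j) (k, l) := by
  have hO : diagonal (fun i : Fin d => if i = a then (-1 : ℝ) else 1)
      * (diagonal (fun i : Fin d => if i = a then (-1 : ℝ) else 1))ᵀ = 1 := by
    rw [diagonal_transpose, diagonal_mul_diagonal, ← diagonal_one]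
    congr 1
    ext i
    split_ifs <;> norm_num
  have := h.sum_eq hO (i, j) (k, l)
  rw [Fintype.sum_eq_single (k, l), Fintype.sum_eq_single (i, j)] at this
  · simpa [apply_ite Complex.ofReal] using this
  · rintro ⟨b, c⟩ hbc
    by_cases h1 : i = b <;> by_cases h2 : j = c <;> simp_all [diagonal_apply]
  · rintro ⟨b, c⟩ hbc
    by_cases h1 : b = k <;> by_cases h2 : c = l <;> simp_all [diagonal_apply]

/-- Entries whose four indices do not pair up vanish. -/
lemma apply_eq_zero (h : CommutesDiagonalOrthogonal X) {i j k l : Fin d}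
    (h₁ : ¬(i = j ∧ k = l)) (h₂ : ¬(i = k ∧ j = l)) (h₃ : ¬(i = l ∧ j = k)) :
    X (i, j) (k, l) = 0 := by
  have hi := h.sign_mul i i j k l
  have hj := h.sign_mul j i j k l
  have hk := h.sign_mul k i j k l
  have hl := h.sign_mul l i j k l
  grind

lemma apply_diag (h : CommutesDiagonalOrthogonal X) {i j : Fin d} (hij : i ≠ j) :
    X (i, i) (i, i) = X (i, j) (i, j) + X (i, j) (j, i) + X (i, i) (j, j) := by
  set v : Fin d → ℝ := Pi.single i 1 + Pi.single j 2 with hv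
  set O : Matrix (Fin d) (Fin d) ℝ := 1 - (2 / 5 : ℝ) • vecMulVec v v with hOdef
  have hvv : v ⬝ᵥ v = 5 := by
    simp [hv, hij, hij.symm]
    norm_num
  have hO : O * Oᵀ = 1 := by
    have hV : vecMulVec v v * vecMulVec v v = (5 : ℝ) • vecMulVec v v := by
      rw [vecMulVec_mul_vecMulVec, hvv, vecMulVec_smul]
    rw [hOdef, transpose_sub, transpose_smul, transpose_vecMulVec, transpose_one]
    simp only [sub_mul, mul_sub, one_mul, mul_one, smul_mul_smul_comm, hV, smul_smul]
    module
  have hii : O i i = 3 / 5 := by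
    simp [hOdef, hv, vecMulVec_apply, hij]; norm_num
  have hij' : O i j = -4 / 5 := by
    simp [hOdef, hv, vecMulVec_apply, hij, hij.symm]; norm_num
  have hji : O j i = -4 / 5 := by
    simp [hOdef, hv, vecMulVec_apply, hij, hij.symm]; norm_num
  have hjj : O j j = -3 / 5 := by
    simp [hOdef, hv, vecMulVec_apply, hij.symm]; norm_num
  have hki : ∀ k, k ≠ i → k ≠ j → O k i = 0 := by
    intro k h1 h2
    simp [hOdef, hv, vecMulVec_apply, h1, h2]
  have hne : (i, i) ≠ (j, j) := by simp [hij]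
  have hne' : (i, j) ≠ (j, i) := by simp [hij]
  have := h.sum_eq hO (i, i) (i, j)
  rw [Fintype.sum_eq_add (i, i) (j, j) hne, Fintype.sum_eq_add (i, j) (j, i) hne'] at this
  · have hswap : X (j, i) (i, j) = X (i, j) (j, i) := by
      simpa using h.apply_perm (Equiv.swap i j) i j j i
    simp only [hii, hij', hji, hjj, hswap] at this
    push_cast at this
    linear_combination (-25 / 12) * this
  · rintro ⟨k, l⟩ ⟨h1, h2⟩
    rw [h.apply_eq_zero, mul_zero] <;> grind
  · rintro ⟨k, l⟩ ⟨h1, h2⟩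
    by_cases hkl : k = l
    · subst hkl
      simp [hki k (by grind) (by grind)]
    · rw [h.apply_eq_zero, zero_mul] <;> grind

lemma one : CommutesDiagonalOrthogonal (1 : Matrix (Fin d × Fin d) (Fin d × Fin d) ℂ) :=
  fun _ _ => by rw [one_mul, mul_one]

lemma add {Y : Matrix (Fin d × Fin d) (Fin d × Fin d) ℂ} (hX : CommutesDiagonalOrthogonal X)
    (hY : CommutesDiagonalOrthogonal Y) : CommutesDiagonalOrthogonal (X + Y) :=
  fun O hO => by rw [add_mul, mul_add, hX O hO, hY O hO]

lemma smul (hX : CommutesDiagonalOrthogonal X) (c : ℂ) : CommutesDiagonalOrthogonal (c • X) :=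
  fun O hO => by rw [smul_mul_assoc, mul_smul_comm, hX O hO]

lemma of_swapMat : CommutesDiagonalOrthogonal (swapMat d) := by
  intro O _
  ext ⟨i, j⟩ ⟨k, l⟩
  rw [mul_apply, mul_apply, Fintype.sum_eq_single (j, i), Fintype.sum_eq_single (l, k)]
  · simp [swapMat, mul_comm]
  · rintro ⟨a, b⟩ hab
    have : ¬(a = l ∧ b = k) := by simpa using hab
    simp [swapMat, this]
  · rintro ⟨a, b⟩ hab
    have : ¬(i = b ∧ j = a) := by grind
    simp [swapMat, this]

lemma of_eMat : CommutesDiagonalOrthogonal (eMat d) := by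
  intro O hO
  have hO' : Oᵀ * O = 1 := mul_eq_one_comm.mp hO
  ext ⟨i, j⟩ ⟨k, l⟩
  have hr : ∑ a, (O i a : ℂ) * O j a = if i = j then 1 else 0 := by
    have := congrArg Complex.ofReal (congrFun (congrFun hO i) j)
    simpa [mul_apply, one_apply, apply_ite Complex.ofReal] using this
  have hc : ∑ a, (O a k : ℂ) * O a l = if k = l then 1 else 0 := by
    have := congrArg Complex.ofReal (congrFun (congrFun hO' k) l)
    simpa [mul_apply, one_apply, apply_ite Complex.ofReal] using this
  have hL : ∑ x, ∑ y, eMat d (i, j) (x, y) * ((O x k : ℂ) * O y l)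
      = (if i = j then 1 else 0) * ∑ a, (O a k : ℂ) * O a l := by
    simp [eMat, ite_and]
  have hR : ∑ x, ∑ y, ((O i x : ℂ) * O j y) * eMat d (x, y) (k, l)
      = (∑ a, (O i a : ℂ) * O j a) * (if k = l then 1 else 0) := by
    simp [eMat, ite_and]
  simp only [mul_apply, Fintype.sum_prod_type, kroneckerMap_apply, map_apply]
  rw [hL, hR, hr, hc]

end CommutesDiagonalOrthogonal

lemma exists_perm_apply_pair {α : Type*} [DecidableEq α] {a b i j : α} (hab : a ≠ b)
    (hij : i ≠ j) : ∃ σ : Equiv.Perm α, σ a = i ∧ σ b = j := by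
  refine ⟨(Equiv.swap (Equiv.swap a i b) j) * Equiv.swap a i, ?_, by simp⟩
  have hne : i ≠ Equiv.swap a i b := by
    intro h
    exact hab ((Equiv.swap a i).injective (by simpa using h))
  simp [Equiv.swap_apply_of_ne_of_ne hne hij]


/-- a `d²×d²` complex matrix `X` commutes with `O ⊗ O` for every real
orthogonal `d×d` matrix `O` iff `X` is a complex linear combination of `1`, the swap
matrix `S`, and the matrix `E`. -/
theorem stmt_1 (d : ℕ) (hd : 1 ≤ d) (X : Matrix (Fin d × Fin d) (Fin d × Fin d) ℂ) :
    (∀ O : Matrix (Fin d) (Fin d) ℝ, O * Oᵀ = 1 →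
      X * ((O.map (Complex.ofReal)) ⊗ₖ (O.map (Complex.ofReal)))
        = ((O.map (Complex.ofReal)) ⊗ₖ (O.map (Complex.ofReal))) * X) ↔
    (∃ α β γ : ℂ, X = α • (1 : Matrix (Fin d × Fin d) (Fin d × Fin d) ℂ)
        + β • swapMat d + γ • eMat d) := by
  refine ⟨fun h => ?_, ?_⟩
  · replace h : CommutesDiagonalOrthogonal X := h
    obtain rfl | hd := hd.eq_or_lt
    · refine ⟨X 0 0, 0, 0, ?_⟩
      ext p q
      simp [Subsingleton.elim p 0, Subsingleton.elim q 0]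
    · let a : Fin d := ⟨0, by omega⟩
      let b : Fin d := ⟨1, hd⟩
      have hab : a ≠ b := by simp [a, b]
      refine ⟨X (a, b) (a, b), X (a, b) (b, a), X (a, a) (b, b), ?_⟩
      have key : ∀ i j, i ≠ j → X (i, j) (i, j) = X (a, b) (a, b) ∧
          X (i, j) (j, i) = X (a, b) (b, a) ∧ X (i, i) (j, j) = X (a, a) (b, b) := by
        intro i j hij
        obtain ⟨σ, rfl, rfl⟩ := exists_perm_apply_pair hab hij
        simp only [h.apply_perm, and_self]
      have diag : ∀ i, X (i, i) (i, i)
          = X (a, b) (a, b) + X (a, b) (b, a) + X (a, a) (b, b) := by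
        intro i
        obtain ⟨j, hij⟩ : ∃ j, i ≠ j := by
          by_cases hi : i = a
          · exact ⟨b, hi ▸ hab⟩
          · exact ⟨a, hi⟩
        obtain ⟨h1, h2, h3⟩ := key i j hij
        rw [h.apply_diag hij, h1, h2, h3]
      ext ⟨i, j⟩ ⟨k, l⟩
      have hzero := h.apply_eq_zero (i := i) (j := j) (k := k) (l := l)
      simp only [Matrix.add_apply, Matrix.smul_apply, one_apply, swapMat, eMat, of_apply,
        smul_eq_mul, Prod.mk.injEq]
      grind
  · rintro ⟨α, β, γ, rfl⟩
    exact ((CommutesDiagonalOrthogonal.one.smul α).add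
      (CommutesDiagonalOrthogonal.of_swapMat.smul β)).add (CommutesDiagonalOrthogonal.of_eMat.smul γ)
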